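/- arXiv:math/0012066 — 2 statements merged into one kernel-verified Lean document; each statement's English description precedes it below -/
import Mathlib

section
/- For a semisimple finite-dimensional Lie algebra 𝔤 over a field of characteristic zero, the universal enveloping algebra decomposes as a direct sum of 𝔤-modules U(𝔤) = [U(𝔤)]^𝔤 ⊕ [U(𝔤), U(𝔤)], where [U(𝔤),U(𝔤)] is the linear span of commutators. -/
namespace LieAlgebra

open LieModule Module

variable {k L M : Type*} [Field k] [LieRing L] [LieAlgebra k L]
  [AddCommGroup M] [Module k M] [LieRingModule L M] [LieModule k L M]

theorem IsKilling.lie_top_top_eq_top [FiniteDimensional k L] [IsKilling k L] :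
    ⁅(⊤ : LieIdeal k L), (⊤ : LieIdeal k L)⁆ = ⊤ := by
  have h := LieIdeal.isCompl_killingCompl (⁅(⊤ : LieIdeal k L), (⊤ : LieIdeal k L)⁆)
  suffices LieIdeal.killingCompl k L ⁅(⊤ : LieIdeal k L), (⊤ : LieIdeal k L)⁆ = ⊥ by
    simpa [this] using h.sup_eq_top
  refine (LieSubmodule.eq_bot_iff _).2 fun x hx ↦ ?_
  have hc : x ∈ center k L := fun y ↦ by
    refine (IsKilling.killingForm_nondegenerate k L).1 _ fun z ↦ ?_
    rw [← lie_skew, map_neg, LinearMap.neg_apply, traceForm_apply_lie_apply, neg_eq_zero,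
      traceForm_comm]
    exact (LieIdeal.mem_killingCompl k L _).1 hx _ (LieSubmodule.lie_mem_lie trivial trivial)
  simpa using hc

theorem IsKilling.isTrivial_of_isNilpotent [FiniteDimensional k L] [IsKilling k L]
    [LieModule.IsNilpotent L M] : LieModule.IsTrivial L M := by
  set N := ⁅(⊤ : LieIdeal k L), (⊤ : LieSubmodule k L M)⁆ with hN
  have hNN : N ≤ ⁅(⊤ : LieIdeal k L), N⁆ := by
    rw [hN, LieSubmodule.lie_le_iff]
    intro x hx m _
    rw [← IsKilling.lie_top_top_eq_top, ← LieSubmodule.mem_toSubmodule,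
      LieSubmodule.lieIdeal_oper_eq_linear_span'] at hx
    induction hx using Submodule.span_induction with
    | mem x hx =>
      obtain ⟨y, -, z, -, rfl⟩ := hx
      rw [lie_lie]
      exact sub_mem
        (LieSubmodule.lie_mem_lie trivial (LieSubmodule.lie_mem_lie trivial trivial))
        (LieSubmodule.lie_mem_lie trivial (LieSubmodule.lie_mem_lie trivial trivial))
    | zero => simp
    | add x y _ _ hx hy => rw [add_lie]; exact add_mem hx hy
    | smul c x _ hx => rw [smul_lie]; exact SMulMemClass.smul_mem c hx
  have hle : ∀ n, N ≤ lowerCentralSeries k L M n := by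
    intro n
    induction n with
    | zero => simp
    | succ n ih =>
      rw [lowerCentralSeries_succ]
      exact hNN.trans (LieSubmodule.mono_lie_right _ ih)
  obtain ⟨n, hn⟩ := (isNilpotent_iff k L M).1 inferInstance
  refine ⟨fun x m ↦ ?_⟩
  have hm : ⁅x, m⁆ ∈ N := LieSubmodule.lie_mem_lie trivial trivial
  simpa [hn] using hle n hm

theorem IsKilling.isTrivial_of_traceForm_eq_zero [CharZero k] [FiniteDimensional k L]
    [IsKilling k L] [FiniteDimensional k M] (h : traceForm k L M = 0) :
    LieModule.IsTrivial L M := by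
  have hnil := isNilpotent_derivedSeries_of_traceForm_eq_zero h
  have htop : derivedSeries k L 1 = ⊤ := IsKilling.lie_top_top_eq_top
  have : LieModule.IsNilpotent L M := by
    rw [isNilpotent_iff_forall' (R := k)] at hnil ⊢
    exact fun x ↦ hnil ⟨x, htop ▸ trivial⟩
  exact isTrivial_of_isNilpotent (k := k)

theorem exists_lieModuleHom_trace_ne_zero [CharZero k] [FiniteDimensional k L] [IsKilling k L]
    [FiniteDimensional k M] (h : traceForm k L M ≠ 0) :
    ∃ f : M →ₗ⁅k,L⁆ M, LinearMap.trace k M f ≠ 0 ∧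
      (∀ m, f m ∈ ⁅(⊤ : LieIdeal k L), (⊤ : LieSubmodule k L M)⁆) ∧
      ∀ m, (∀ x : L, ⁅x, m⁆ = 0) → f m = 0 := by
  classical
  let I : LieIdeal k L := LieAlgebra.InvariantForm.orthogonal (traceForm k L M)
    (traceForm_lieInvariant k L M) ⊤
  let J : LieIdeal k L := I.killingCompl
  have hIJ : IsCompl I J := I.isCompl_killingCompl
  let B : LinearMap.BilinForm k J := (traceForm k L M).restrict J
  have hI {x : L} : x ∈ I ↔ ∀ y, traceForm k L M y x = 0 := by
    simp [I, InvariantForm.mem_orthogonal]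
  have hBs : B.IsSymm := ⟨fun x y ↦ traceForm_comm k L M x y⟩
  have hB : B.Nondegenerate := by
    refine hBs.isRefl.nondegenerate_iff_separatingLeft.mpr ?_
    intro x hx
    suffices (x : L) ∈ I ⊓ J by
      rw [hIJ.inf_eq_bot] at this
      simpa using this
    refine ⟨hI.2 fun y ↦ ?_, x.2⟩
    have hy : y ∈ I ⊔ J := by simp [hIJ.sup_eq_top]
    obtain ⟨a, ha, b, hb, rfl⟩ := (LieSubmodule.mem_sup _ _ _).1 hy
    rw [map_add, LinearMap.add_apply, traceForm_comm, hI.1 ha, zero_add, traceForm_comm]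
    exact hx ⟨b, hb⟩
  let b := finBasis k J
  let b' := B.dualBasis hB b
  have hbb (i j) : B (b i) (b' j) = if i = j then 1 else 0 :=
    B.apply_dualBasis_right hB hBs b i j
  have hb (y : J) : y = ∑ i, B y (b' i) • b i := by
    conv_lhs => rw [← b.sum_repr y]
    refine Finset.sum_congr rfl fun i _ ↦ ?_
    have : B (∑ j, b.repr y j • b j) (b' i) = b.repr y i := by
      simp only [map_sum, map_smul, LinearMap.sum_apply, LinearMap.smul_apply, hbb]
      simp
    rw [← this, b.sum_repr]
  have hb' (y : J) : y = ∑ i, B y (b i) • b' i := by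
    simpa [b', B.dualBasis_repr_apply hB b] using (b'.sum_repr y).symm
  let f : M →ₗ[k] M := ∑ i, toEnd k L M (b i) ∘ₗ toEnd k L M (b' i)
  have hf (m : M) : f m = ∑ i, ⁅(b i : L), ⁅(b' i : L), m⁆⁆ := by simp [f]
  refine ⟨{ f with map_lie' := fun {x m} ↦ ?_ }, ?_, ?_, ?_⟩
  · have hinv (x : L) (y z : J) : B ⁅x, y⁆ z = - B ⁅x, z⁆ y := by
      change traceForm k L M ⁅x, (y : L)⁆ z = - traceForm k L M ⁅x, (z : L)⁆ y
      rw [traceForm_comm k L M ⁅x, (z : L)⁆ y, ← traceForm_apply_lie_apply, ← lie_skew, map_neg,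
        LinearMap.neg_apply]
    have h₁ (i) : ⁅x, (b i : L)⁆ = ∑ j, B ⁅x, b i⁆ (b' j) • (b j : L) := by
      simpa using congrArg ((↑) : J → L) (hb ⁅x, b i⁆)
    have h₂ (i) : ⁅x, (b' i : L)⁆ = ∑ j, B ⁅x, b' i⁆ (b j) • (b' j : L) := by
      simpa using congrArg ((↑) : J → L) (hb' ⁅x, b' i⁆)
    change f ⁅x, m⁆ = ⁅x, f m⁆
    have h₃ : ∑ i, ⁅⁅x, (b i : L)⁆, ⁅(b' i : L), m⁆⁆ +
        ∑ i, ⁅(b i : L), ⁅⁅x, (b' i : L)⁆, m⁆⁆ = 0 := by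
      simp only [h₁, h₂, sum_lie, lie_sum, smul_lie, lie_smul]
      rw [Finset.sum_comm, ← Finset.sum_add_distrib]
      refine Finset.sum_eq_zero fun i _ ↦ ?_
      rw [← Finset.sum_add_distrib]
      refine Finset.sum_eq_zero fun j _ ↦ ?_
      rw [hinv x (b j), neg_smul, neg_add_cancel]
    simp only [hf, lie_sum]
    rw [← sub_eq_zero, ← neg_eq_zero, ← h₃, ← Finset.sum_sub_distrib, ← Finset.sum_neg_distrib,
      ← Finset.sum_add_distrib]
    refine Finset.sum_congr rfl fun i _ ↦ ?_
    simp only [lie_lie, lie_sub]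
    abel
  · change LinearMap.trace k M f ≠ 0
    have htr : LinearMap.trace k M f = finrank k J := by
      have (i : Fin (finrank k J)) :
        LinearMap.trace k M (toEnd k L M (b i) ∘ₗ toEnd k L M (b' i)) = 1 :=
        (hbb i i).trans (if_pos rfl)
      simp [f, this]
    rw [htr, Nat.cast_ne_zero]
    intro h0
    have hJ : J = ⊥ := by
      rw [← LieSubmodule.toSubmodule_eq_bot]
      exact Submodule.finrank_eq_zero.1 h0
    refine h (LinearMap.ext fun x ↦ LinearMap.ext fun y ↦ hI.1 ?_ x)
    have hI' : I = ⊤ := by simpa [hJ] using hIJ.sup_eq_top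
    simp [hI']
  · intro m
    change f m ∈ _
    rw [hf]
    exact sum_mem fun i _ ↦ LieSubmodule.lie_mem_lie trivial trivial
  · intro m hm
    change f m = 0
    simp [hf, hm]

theorem isCompl_maxTrivSubmodule_lie_top [CharZero k] [FiniteDimensional k L] [IsKilling k L]
    [FiniteDimensional k M] :
    IsCompl (maxTrivSubmodule k L M) ⁅(⊤ : LieIdeal k L), (⊤ : LieSubmodule k L M)⁆ := by
  induction hn : finrank k M using Nat.strong_induction_on generalizing M with | _ n ih
  subst hn
  by_cases h : traceForm k L M = 0
  · have := IsKilling.isTrivial_of_traceForm_eq_zero h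
    rw [(isTrivial_iff_max_triv_eq_top k L M).1 this, LieSubmodule.trivial_lie_oper_zero]
    exact isCompl_top_bot
  obtain ⟨f, hf, hf_mem, hf_triv⟩ := exists_lieModuleHom_trace_ne_zero h
  obtain ⟨n, hn, hn0⟩ := ((f : M →ₗ[k] M).eventually_isCompl_ker_pow_range_pow.and
    (Filter.eventually_ge_atTop 1)).exists
  have hlie (n : ℕ) (x : L) (m : M) :
      ((f : M →ₗ[k] M) ^ n) ⁅x, m⁆ = ⁅x, ((f : M →ₗ[k] M) ^ n) m⁆ := by
    induction n with
    | zero => simp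
    | succ n ih => simp [pow_succ', ih]
  let K : LieSubmodule k L M :=
    { LinearMap.ker ((f : M →ₗ[k] M) ^ n) with
      lie_mem := fun {x m} (hm : _ = 0) ↦ show _ = 0 by rw [hlie, hm, lie_zero] }
  let R : LieSubmodule k L M :=
    { LinearMap.range ((f : M →ₗ[k] M) ^ n) with
      lie_mem := by
        rintro x - ⟨m, rfl⟩
        exact ⟨⁅x, m⁆, hlie n x m⟩ }
  have hKR : IsCompl K R := (LieSubmodule.isCompl_toSubmodule).1 hn
  have hmemK {m : M} : m ∈ K ↔ ((f : M →ₗ[k] M) ^ n) m = 0 := Iff.rfl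
  have hR : R ≤ ⁅(⊤ : LieIdeal k L), (⊤ : LieSubmodule k L M)⁆ := by
    rintro - ⟨m, rfl⟩
    obtain ⟨n, rfl⟩ := Nat.exists_eq_add_of_le' hn0
    rw [pow_succ']
    exact hf_mem _
  have hK : finrank k K < finrank k M := by
    refine Submodule.finrank_lt fun hK ↦ hf ?_
    have : IsNilpotent (f : M →ₗ[k] M) := ⟨n, LinearMap.ker_eq_top.1 hK⟩
    exact (LinearMap.isNilpotent_trace_of_isNilpotent this).eq_zero
  have hKc := ih _ hK (M := K) rfl
  have hKtop : LieSubmodule.map K.incl ⊤ = K := by simp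
  have hKlie : LieSubmodule.map K.incl ⁅(⊤ : LieIdeal k L), (⊤ : LieSubmodule k L K)⁆ =
      ⁅(⊤ : LieIdeal k L), K⁆ := by
    rw [LieSubmodule.map_bracket_eq, hKtop]
  have htop : (⊤ : LieSubmodule k L M) = K ⊔ R := hKR.sup_eq_top.symm
  refine ⟨?_, ?_⟩
  · rw [disjoint_iff, LieSubmodule.eq_bot_iff]
    rintro m ⟨hm, hm'⟩
    replace hm : ∀ x : L, ⁅x, m⁆ = 0 := hm
    replace hm' : m ∈ ⁅(⊤ : LieIdeal k L), (⊤ : LieSubmodule k L M)⁆ := hm'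
    rw [htop, LieSubmodule.lie_sup, LieSubmodule.mem_sup] at hm'
    obtain ⟨a, ha, b, hb, rfl⟩ := hm'
    have haK := LieSubmodule.lie_le_right _ _ ha
    have hbR := LieSubmodule.lie_le_right _ _ hb
    have hab (x : L) : ⁅x, a⁆ = 0 := by
      have hx := hm x
      rw [lie_add, add_eq_zero_iff_eq_neg] at hx
      refine (LieSubmodule.eq_bot_iff _).1 hKR.inf_eq_bot _ ⟨K.lie_mem haK, ?_⟩
      rw [SetLike.mem_coe, hx]
      exact neg_mem (R.lie_mem hbR)
    have hb0 (x : L) : ⁅x, b⁆ = 0 := by simpa [hab] using hm x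
    have hbK : b ∈ K := by
      obtain ⟨n, rfl⟩ := Nat.exists_eq_add_of_le' hn0
      rw [hmemK, pow_succ]
      simp [hf_triv b hb0]
    have hb_zero : b = 0 := (LieSubmodule.eq_bot_iff _).1 hKR.inf_eq_bot _ ⟨hbK, hbR⟩
    rw [← hKlie, LieSubmodule.mem_map] at ha
    obtain ⟨a, ha, rfl⟩ := ha
    have : a = 0 := (LieSubmodule.eq_bot_iff _).1 hKc.inf_eq_bot _
      ⟨fun x ↦ Subtype.ext (hab x), ha⟩
    simp [this, hb_zero]
  · rw [codisjoint_iff_le_sup, htop]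
    refine sup_le ?_ (htop ▸ hR.trans le_sup_right)
    rw [← htop]
    calc K = LieSubmodule.map K.incl (maxTrivSubmodule k L K ⊔ ⁅⊤, ⊤⁆) := by
          rw [hKc.sup_eq_top, hKtop]
      _ ≤ _ := by
        rw [LieSubmodule.map_sup, hKlie]
        refine sup_le_sup ?_ (LieSubmodule.mono_lie_right _ le_top)
        rintro - ⟨a, ha, rfl⟩ x
        exact congrArg ((↑) : K → M) (ha x)

theorem isCompl_maxTrivSubmodule_lie_top_of_locallyFinite [CharZero k] [FiniteDimensional k L]
    [IsKilling k L] (h : ∀ m : M, ∃ N : LieSubmodule k L M, FiniteDimensional k N ∧ m ∈ N) :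
    IsCompl (maxTrivSubmodule k L M) ⁅(⊤ : LieIdeal k L), (⊤ : LieSubmodule k L M)⁆ := by
  have hmap (N : LieSubmodule k L M) :
      LieSubmodule.map N.incl ⁅(⊤ : LieIdeal k L), (⊤ : LieSubmodule k L N)⁆ =
        ⁅(⊤ : LieIdeal k L), N⁆ := by
    rw [LieSubmodule.map_bracket_eq]
    simp
  have hlie (m : M) (hm : m ∈ ⁅(⊤ : LieIdeal k L), (⊤ : LieSubmodule k L M)⁆) :
      ∃ N : LieSubmodule k L M, FiniteDimensional k N ∧ m ∈ ⁅(⊤ : LieIdeal k L), N⁆ := by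
    rw [← LieSubmodule.mem_toSubmodule, LieSubmodule.lieIdeal_oper_eq_linear_span'] at hm
    induction hm using Submodule.span_induction with
    | mem m hm =>
      obtain ⟨x, -, m, -, rfl⟩ := hm
      obtain ⟨N, hN, hm⟩ := h m
      exact ⟨N, hN, LieSubmodule.lie_mem_lie trivial hm⟩
    | zero => exact ⟨⊥, inferInstanceAs (FiniteDimensional k (⊥ : Submodule k M)), zero_mem _⟩
    | add a b _ _ ha hb =>
      obtain ⟨A, hA, ha⟩ := ha
      obtain ⟨B, hB, hb⟩ := hb
      refine ⟨A ⊔ B, ?_, add_mem (LieSubmodule.mono_lie_right _ le_sup_left ha)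
        (LieSubmodule.mono_lie_right _ le_sup_right hb)⟩
      have : FiniteDimensional k A.toSubmodule := hA
      have : FiniteDimensional k B.toSubmodule := hB
      change FiniteDimensional k (A ⊔ B).toSubmodule
      rw [LieSubmodule.sup_toSubmodule]
      infer_instance
    | smul c m _ hm =>
      obtain ⟨N, hN, hm⟩ := hm
      exact ⟨N, hN, SMulMemClass.smul_mem c hm⟩
  refine ⟨?_, ?_⟩
  · rw [disjoint_iff, LieSubmodule.eq_bot_iff]
    rintro m ⟨hm, hm'⟩
    obtain ⟨N, _, hmN⟩ := hlie m hm'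
    rw [← hmap, LieSubmodule.mem_map] at hmN
    obtain ⟨a, ha, rfl⟩ := hmN
    have : a = 0 := (LieSubmodule.eq_bot_iff _).1
      (isCompl_maxTrivSubmodule_lie_top (k := k) (L := L) (M := N)).inf_eq_bot _
      ⟨fun x ↦ Subtype.ext (hm x), ha⟩
    simp [this]
  · rw [codisjoint_iff_le_sup]
    intro m _
    obtain ⟨N, _, hmN⟩ := h m
    have hm : (⟨m, hmN⟩ : N) ∈
        maxTrivSubmodule k L N ⊔ ⁅(⊤ : LieIdeal k L), (⊤ : LieSubmodule k L N)⁆ := by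
      simp [isCompl_maxTrivSubmodule_lie_top.sup_eq_top]
    obtain ⟨a, ha, b, hb, hab⟩ := (LieSubmodule.mem_sup _ _ _).1 hm
    refine (LieSubmodule.mem_sup _ _ _).2 ⟨a, fun x ↦ congrArg ((↑) : N → M) (ha x), b, ?_,
      congrArg ((↑) : N → M) hab⟩
    refine LieSubmodule.mono_lie_right _ (le_top (a := N)) ?_
    rw [← hmap]
    exact LieSubmodule.mem_map_of_mem hb

end LieAlgebra

namespace UniversalEnvelopingAlgebra

attribute [local instance] LieRing.ofAssociativeRing

variable {k L : Type*} [CommRing k] [LieRing L] [LieAlgebra k L]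

theorem adjoin_range_ι :
    Algebra.adjoin k (Set.range (ι k : L → UniversalEnvelopingAlgebra k L)) = ⊤ := by
  set S := Algebra.adjoin k (Set.range (ι k : L → UniversalEnvelopingAlgebra k L))
  let g : L →ₗ⁅k⁆ S :=
    { toFun x := ⟨ι k x, Algebra.subset_adjoin ⟨x, rfl⟩⟩
      map_add' x y := Subtype.ext (map_add (ι k) x y)
      map_smul' c x := Subtype.ext (map_smul (ι k) c x)
      map_lie' {x y} := Subtype.ext (LieHom.map_lie (ι k) x y) }
  have h : S.val.comp (lift k g) = AlgHom.id k _ := by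
    refine hom_ext k (LieHom.ext fun x ↦ ?_)
    change ((lift k g (ι k x) : S) : UniversalEnvelopingAlgebra k L) = ι k x
    rw [lift_ι_apply]
    rfl
  refine Algebra.eq_top_iff.2 fun u ↦ ?_
  rw [← AlgHom.id_apply (R := k) u, ← h]
  exact (lift k g u).2

theorem induction_on {p : UniversalEnvelopingAlgebra k L → Prop} (u : UniversalEnvelopingAlgebra k L)
    (ι : ∀ x, p (ι k x)) (algebraMap : ∀ c, p (algebraMap k _ c))
    (add : ∀ a b, p a → p b → p (a + b)) (mul : ∀ a b, p a → p b → p (a * b)) : p u := by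
  have hu : u ∈ Algebra.adjoin k (Set.range (UniversalEnvelopingAlgebra.ι k : L → _)) := by
    rw [adjoin_range_ι]
    trivial
  induction hu using Algebra.adjoin_induction with
  | mem u hu => obtain ⟨x, rfl⟩ := hu; exact ι x
  | algebraMap c => exact algebraMap c
  | add a b _ _ ha hb => exact add a b ha hb
  | mul a b _ _ ha hb => exact mul a b ha hb

/-- Every element of the enveloping algebra lies in a finitely generated submodule which is stable
under the adjoint action. -/
theorem exists_fg_stable_submodule [Module.Finite k L] (u : UniversalEnvelopingAlgebra k L) :
    ∃ N : Submodule k (UniversalEnvelopingAlgebra k L), N.FG ∧ u ∈ N ∧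
      ∀ x : L, ∀ v ∈ N, ⁅ι k x, v⁆ ∈ N := by
  induction u using induction_on with
  | ι x =>
    refine ⟨LinearMap.range (ι k (L := L) : L →ₗ[k] UniversalEnvelopingAlgebra k L),
      Module.Finite.iff_fg.1 inferInstance, LinearMap.mem_range_self _ x, ?_⟩
    rintro x - ⟨y, rfl⟩
    exact ⟨⁅x, y⁆, LieHom.map_lie (ι k) x y⟩
  | algebraMap c =>
    refine ⟨1, ⟨{1}, by simp [Submodule.one_eq_span]⟩, Submodule.algebraMap_mem c, fun x v hv ↦ ?_⟩
    obtain ⟨c, rfl⟩ := Submodule.mem_one.1 hv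
    rw [LieRing.of_associative_ring_bracket, Algebra.commutes, sub_self]
    exact zero_mem _
  | add a b ha hb =>
    obtain ⟨A, hA, ha, hA'⟩ := ha
    obtain ⟨B, hB, hb, hB'⟩ := hb
    refine ⟨A ⊔ B, hA.sup hB, Submodule.add_mem_sup ha hb, fun x v hv ↦ ?_⟩
    obtain ⟨a, ha, b, hb, rfl⟩ := Submodule.mem_sup.1 hv
    rw [lie_add]
    exact Submodule.add_mem_sup (hA' x a ha) (hB' x b hb)
  | mul a b ha hb =>
    obtain ⟨A, hA, ha, hA'⟩ := ha
    obtain ⟨B, hB, hb, hB'⟩ := hb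
    refine ⟨A * B, hA.mul hB, Submodule.mul_mem_mul ha hb, fun x v hv ↦ ?_⟩
    induction hv using Submodule.mul_induction_on' with
    | mem_mul_mem a ha b hb =>
      have : ⁅ι k x, a * b⁆ = ⁅ι k x, a⁆ * b + a * ⁅ι k x, b⁆ := by
        simp only [LieRing.of_associative_ring_bracket]
        noncomm_ring
      rw [this]
      exact add_mem (Submodule.mul_mem_mul (hA' x a ha) hb)
        (Submodule.mul_mem_mul ha (hB' x b hb))
    | add a _ b _ ha hb => rw [lie_add]; exact add_mem ha hb

theorem span_commutators_eq_span_lie :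
    Submodule.span k {c : UniversalEnvelopingAlgebra k L | ∃ a e, a * e - e * a = c} =
      Submodule.span k {c | ∃ (x : L) (u : UniversalEnvelopingAlgebra k L), ⁅ι k x, u⁆ = c} := by
  refine le_antisymm (Submodule.span_le.2 ?_) (Submodule.span_mono ?_)
  · rintro - ⟨a, e, rfl⟩
    rw [SetLike.mem_coe]
    induction a using induction_on generalizing e with
    | ι x => exact Submodule.subset_span ⟨x, e, LieRing.of_associative_ring_bracket _ _⟩
    | algebraMap c => simp [Algebra.commutes c e]
    | add a b ha hb =>
      convert add_mem (ha e) (hb e) using 1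
      noncomm_ring
    | mul a b ha hb =>
      convert add_mem (ha (b * e)) (hb (e * a)) using 1
      noncomm_ring
  · rintro - ⟨x, u, rfl⟩
    exact ⟨ι k x, u, (LieRing.of_associative_ring_bracket _ _).symm⟩

theorem isCompl_invariants_span_commutators {k L : Type*} [Field k] [CharZero k] [LieRing L]
    [LieAlgebra k L] [FiniteDimensional k L] [LieAlgebra.IsKilling k L] :
    IsCompl
      (⨅ x : L, LinearMap.ker (LinearMap.mulLeft k (ι k x) - LinearMap.mulRight k (ι k x)))
      (Submodule.span k {c : UniversalEnvelopingAlgebra k L | ∃ a e, a * e - e * a = c}) := by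
  let _ : LieRingModule L (UniversalEnvelopingAlgebra k L) :=
    LieRingModule.compLieHom _ (ι k : L →ₗ⁅k⁆ UniversalEnvelopingAlgebra k L)
  have : LieModule k L (UniversalEnvelopingAlgebra k L) :=
    LieModule.compLieHom _ (ι k : L →ₗ⁅k⁆ UniversalEnvelopingAlgebra k L)
  have h := LieAlgebra.isCompl_maxTrivSubmodule_lie_top_of_locallyFinite (k := k) (L := L)
    (M := UniversalEnvelopingAlgebra k L) fun u ↦ by
      obtain ⟨N, hN, hu, hN'⟩ := exists_fg_stable_submodule u
      exact ⟨{ N with lie_mem := fun {x m} hm ↦ hN' x m hm }, Module.Finite.iff_fg.2 hN, hu⟩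
  rw [← LieSubmodule.isCompl_toSubmodule] at h
  convert h using 1
  · ext u
    simp only [Submodule.mem_iInf, LinearMap.mem_ker]
    rfl
  · rw [span_commutators_eq_span_lie, LieSubmodule.lieIdeal_oper_eq_linear_span']
    congr 1
    ext c
    simp
    rfl

end UniversalEnvelopingAlgebra


/-- For a semisimple finite-dimensional Lie algebra `𝔤` over a field of
characteristic zero, the universal enveloping algebra decomposes as a direct sum of
`𝔤`-modules `U(𝔤) = [U(𝔤)]^𝔤 ⊕ [U(𝔤), U(𝔤)]`, where `[U(𝔤),U(𝔤)]` is the linear span of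
commutators.  The `𝔤`-action is `x·ω = ι(x)ω − ωι(x)`; the invariants are
`⨅ x, ker(ad ι(x))` and we assert that they are complementary to the span of commutators,
both being stable under the action. -/
theorem enveloping_algebra_decomposition_semisimple
    {k : Type} [Field k] [CharZero k]
    {𝔤 : Type} [LieRing 𝔤] [LieAlgebra k 𝔤] [FiniteDimensional k 𝔤]
    [LieAlgebra.IsSemisimple k 𝔤] :
    IsCompl
      (⨅ x : 𝔤, LinearMap.ker
        (LinearMap.mulLeft k ((UniversalEnvelopingAlgebra.ι k x : UniversalEnvelopingAlgebra k 𝔤))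
          - LinearMap.mulRight k (UniversalEnvelopingAlgebra.ι k x)))
      (Submodule.span k {c : UniversalEnvelopingAlgebra k 𝔤 |
        ∃ a e : UniversalEnvelopingAlgebra k 𝔤, a * e - e * a = c})
    ∧ (∀ (x : 𝔤), ∀ u ∈ ⨅ y : 𝔤, LinearMap.ker
        (LinearMap.mulLeft k ((UniversalEnvelopingAlgebra.ι k y : UniversalEnvelopingAlgebra k 𝔤))
          - LinearMap.mulRight k (UniversalEnvelopingAlgebra.ι k y)),
        UniversalEnvelopingAlgebra.ι k x * u - u * UniversalEnvelopingAlgebra.ι k x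
          ∈ ⨅ y : 𝔤, LinearMap.ker
            (LinearMap.mulLeft k ((UniversalEnvelopingAlgebra.ι k y : UniversalEnvelopingAlgebra k 𝔤))
              - LinearMap.mulRight k (UniversalEnvelopingAlgebra.ι k y)))
    ∧ (∀ (x : 𝔤), ∀ u ∈ Submodule.span k {c : UniversalEnvelopingAlgebra k 𝔤 |
          ∃ a e : UniversalEnvelopingAlgebra k 𝔤, a * e - e * a = c},
        UniversalEnvelopingAlgebra.ι k x * u - u * UniversalEnvelopingAlgebra.ι k x
          ∈ Submodule.span k {c : UniversalEnvelopingAlgebra k 𝔤 |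
              ∃ a e : UniversalEnvelopingAlgebra k 𝔤, a * e - e * a = c}) := by
  refine ⟨UniversalEnvelopingAlgebra.isCompl_invariants_span_commutators, fun x u hu ↦ ?_,
    fun x u _ ↦ Submodule.subset_span ⟨_, _, rfl⟩⟩
  have hx := (Submodule.mem_iInf _).1 hu x
  rw [LinearMap.mem_ker, LinearMap.sub_apply, LinearMap.mulLeft_apply, LinearMap.mulRight_apply]
    at hx
  rw [hx]
  exact zero_mem _
end

section
/- (Main theorem for semisimple 𝔤, deduced from Duflo) Let 𝔤 be a finite-dimensional semisimple Lie algebra over a field of characteristic zero. For any α ∈ [S(𝔤)]^𝔤 and any β ∈ S(𝔤), there exists c(α,β) ∈ {S(𝔤), S(𝔤)} such that φ_D(α·β + c(α,β)) = φ_D(α) ⋆ φ_D(β), where ⋆ is the product in U(𝔤). -/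
open LieAlgebra LieModule in
/-- Over a perfect Lie algebra in characteristic zero, a finite-dimensional module with vanishing
trace form is trivial. -/
lemma lie_top_eq_bot_of_traceForm_eq_zero {k L V : Type*} [Field k] [CharZero k]
    [LieRing L] [LieAlgebra k L] (hL : derivedSeries k L 1 = ⊤)
    [AddCommGroup V] [Module k V] [LieRingModule L V] [LieModule k L V] [FiniteDimensional k V]
    (h : traceForm k L V = 0) : ⁅(⊤ : LieIdeal k L), (⊤ : LieSubmodule k L V)⁆ = ⊥ := by
  have hnil := isNilpotent_derivedSeries_of_traceForm_eq_zero h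
  have hnil' : LieModule.IsNilpotent L V := by
    rw [isNilpotent_iff_forall' (R := k)] at hnil ⊢
    exact fun x => hnil ⟨x, hL ▸ LieSubmodule.mem_top x⟩
  have hstep : ∀ N : LieSubmodule k L V,
      ⁅(⊤ : LieIdeal k L), N⁆ ≤ ⁅(⊤ : LieIdeal k L), ⁅(⊤ : LieIdeal k L), N⁆⁆ := by
    intro N
    conv_lhs => rw [← hL]
    rw [LieSubmodule.lieIdeal_oper_eq_span, LieSubmodule.lieSpan_le]
    rintro _ ⟨⟨x, hx⟩, ⟨m, hm⟩, rfl⟩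
    change ⁅x, m⁆ ∈ ⁅(⊤ : LieIdeal k L), ⁅(⊤ : LieIdeal k L), N⁆⁆
    rw [derivedSeries_def, derivedSeriesOfIdeal_succ, derivedSeriesOfIdeal_zero,
      ← LieSubmodule.mem_toSubmodule, LieSubmodule.lieIdeal_oper_eq_linear_span'] at hx
    induction hx using Submodule.span_induction with
    | mem x hx =>
      obtain ⟨y, -, z, -, rfl⟩ := hx
      rw [lie_lie]
      have hmem : ∀ y z : L, ⁅y, ⁅z, m⁆⁆ ∈ ⁅(⊤ : LieIdeal k L), ⁅(⊤ : LieIdeal k L), N⁆⁆ :=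
        fun y z => LieSubmodule.lie_mem_lie (LieSubmodule.mem_top y)
          (LieSubmodule.lie_mem_lie (LieSubmodule.mem_top z) hm)
      exact sub_mem (hmem y z) (hmem z y)
    | zero => simp
    | add x y _ _ hx hy => rw [add_lie]; exact add_mem hx hy
    | smul c x _ hx => rw [smul_lie]; exact SMulMemClass.smul_mem c hx
  obtain ⟨n, hn⟩ := (LieModule.isNilpotent_iff k L V).mp hnil'
  have hle : ∀ n, ⁅(⊤ : LieIdeal k L), (⊤ : LieSubmodule k L V)⁆ ≤ lowerCentralSeries k L V n := by
    intro n
    induction n with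
    | zero => simp
    | succ n ih =>
      rw [LieModule.lowerCentralSeries_succ]
      exact (hstep ⊤).trans (LieSubmodule.mono_lie_right _ ih)
  exact le_bot_iff.mp (hn ▸ hle n)

open LieAlgebra LieModule in
lemma derivedSeries_one_eq_top_of_isKilling {k L : Type*} [Field k]
    [LieRing L] [LieAlgebra k L] [FiniteDimensional k L] [IsKilling k L] :
    derivedSeries k L 1 = ⊤ := by
  have hcompl := LieIdeal.isCompl_killingCompl (derivedSeries k L 1)
  suffices (derivedSeries k L 1).killingCompl = ⊥ by
    rw [this] at hcompl
    exact eq_top_of_isCompl_bot hcompl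
  rw [eq_bot_iff]
  intro x hx
  rw [← center_eq_bot k L, LieModule.mem_maxTrivSubmodule]
  intro y
  refine (IsKilling.killingForm_nondegenerate k L).1 _ fun z => ?_
  rw [← lie_skew, map_neg, LinearMap.neg_apply, neg_eq_zero, traceForm_apply_lie_apply,
    traceForm_comm]
  refine (LieIdeal.mem_killingCompl k L _).mp hx _ ?_
  rw [derivedSeries_def, derivedSeriesOfIdeal_succ, derivedSeriesOfIdeal_zero]
  exact LieSubmodule.lie_mem_lie (LieSubmodule.mem_top y) (LieSubmodule.mem_top z)

open LieAlgebra LieModule in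
/-- The Casimir operator of an ideal on which the trace form of `V` is nondegenerate. -/
lemma exists_lieModuleHom_trace_ne_zero {k L V : Type*} [Field k] [CharZero k]
    [LieRing L] [LieAlgebra k L] [FiniteDimensional k L]
    [AddCommGroup V] [Module k V] [LieRingModule L V] [LieModule k L V]
    (I : LieIdeal k L) (hI : I ≠ ⊥) (hB : (traceForm k I V).Nondegenerate) :
    ∃ C : V →ₗ⁅k,L⁆ V, (∀ v, C v ∈ ⁅(⊤ : LieIdeal k L), (⊤ : LieSubmodule k L V)⁆) ∧
      LinearMap.trace k V C ≠ 0 := by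
  let b := Module.finBasis k I
  let B := traceForm k I V
  let b' := B.dualBasis hB b
  let C : Module.End k V := ∑ i, toEnd k L V (b i) * toEnd k L V (b' i)
  have hCv : ∀ v, C v = ∑ i, ⁅(b i : L), ⁅(b' i : L), v⁆⁆ := by
    intro v
    simp [C, LinearMap.sum_apply]
  have hb : ∀ y : I, (y : L) = ∑ j, B y (b' j) • (b j : L) := by
    intro y
    have h1 := b.sum_repr y
    have h2 : ∀ j, b.repr y j = B y (b' j) := by
      intro j
      have := LinearMap.BilinForm.dualBasis_repr_apply (B := B) hB b' y j
      rwa [LinearMap.BilinForm.dualBasis_dualBasis hB ⟨traceForm_comm k I V⟩] at this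
    simp_rw [h2] at h1
    conv_lhs => rw [← h1]
    simp
  have hb' : ∀ y : I, (y : L) = ∑ j, B y (b j) • (b' j : L) := by
    intro y
    have h1 := b'.sum_repr y
    simp_rw [b', LinearMap.BilinForm.dualBasis_repr_apply (B := B) hB b y] at h1
    conv_lhs => rw [← h1]
    simp [b']
  have hinv : ∀ (x : L) (y z : I), B ⁅x, y⁆ z = - B ⁅x, z⁆ y := by
    intro x y z
    have := traceForm_apply_lie_apply' k L V x (y : L) (z : L)
    rw [traceForm_comm k L V (y : L)] at this
    exact this
  have hC : ∀ x : L, ∀ v, C ⁅x, v⁆ = ⁅x, C v⁆ := by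
    intro x v
    have h1 : ∀ i, ⁅x, ⁅(b i : L), ⁅(b' i : L), v⁆⁆⁆ = ⁅(b i : L), ⁅(b' i : L), ⁅x, v⁆⁆⁆ +
        (⁅⁅x, (b i : L)⁆, ⁅(b' i : L), v⁆⁆ + ⁅(b i : L), ⁅⁅x, (b' i : L)⁆, v⁆⁆) := by
      intro i
      rw [leibniz_lie x (b i : L), leibniz_lie x (b' i : L), lie_add]
      abel
    have h2 : ∀ i, ⁅⁅x, (b i : L)⁆, ⁅(b' i : L), v⁆⁆ =
        ∑ j, B ⁅x, b i⁆ (b' j) • ⁅(b j : L), ⁅(b' i : L), v⁆⁆ := by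
      intro i
      have := hb ⁅x, b i⁆
      rw [LieSubmodule.coe_bracket] at this
      rw [this, sum_lie]
      simp
    have h3 : ∀ i, ⁅(b i : L), ⁅⁅x, (b' i : L)⁆, v⁆⁆ =
        -∑ j, B ⁅x, b j⁆ (b' i) • ⁅(b i : L), ⁅(b' j : L), v⁆⁆ := by
      intro i
      have := hb' ⁅x, b' i⁆
      rw [LieSubmodule.coe_bracket] at this
      rw [this, sum_lie, lie_sum, ← Finset.sum_neg_distrib]
      refine Finset.sum_congr rfl fun j _ => ?_
      rw [hinv x (b' i) (b j)]
      simp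
    rw [hCv, hCv, lie_sum]
    simp_rw [h1, h2, h3, Finset.sum_add_distrib, Finset.sum_neg_distrib]
    rw [Finset.sum_comm, add_neg_cancel, add_zero]
  refine ⟨{ C with map_lie' := fun {x v} => hC x v }, ?_, ?_⟩
  · intro v
    change C v ∈ _
    rw [hCv]
    exact sum_mem fun i _ => LieSubmodule.lie_mem_lie (LieSubmodule.mem_top _)
      (LieSubmodule.mem_top _)
  · change LinearMap.trace k V C ≠ 0
    have h1 : ∀ i, LinearMap.trace k V (toEnd k L V (b i) * toEnd k L V (b' i)) = 1 := by
      intro i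
      have := LinearMap.BilinForm.apply_dualBasis_right (B := B) hB ⟨traceForm_comm k I V⟩ b i i
      rwa [if_pos rfl] at this
    simp only [C, map_sum, h1, Finset.sum_const, Finset.card_univ, Fintype.card_fin, nsmul_eq_mul,
      mul_one, ne_eq, Nat.cast_eq_zero]
    have : Nontrivial I := (LieSubmodule.nontrivial_iff_ne_bot k L L).mpr hI
    exact Module.finrank_pos.ne'

open LieAlgebra LieModule in
lemma map_incl_maxTrivSubmodule_sup_lie_top_le {k L M : Type*} [CommRing k]
    [LieRing L] [LieAlgebra k L]
    [AddCommGroup M] [Module k M] [LieRingModule L M] [LieModule k L M] (N : LieSubmodule k L M) :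
    (maxTrivSubmodule k L N ⊔ ⁅(⊤ : LieIdeal k L), (⊤ : LieSubmodule k L N)⁆).map N.incl ≤
      maxTrivSubmodule k L M ⊔ ⁅(⊤ : LieIdeal k L), (⊤ : LieSubmodule k L M)⁆ := by
  rw [LieSubmodule.map_sup, LieSubmodule.map_bracket_eq]
  refine sup_le_sup ?_ (LieSubmodule.mono_lie_right _ le_top)
  rintro _ ⟨z, hz, rfl⟩
  rw [mem_maxTrivSubmodule]
  intro x
  exact congrArg N.incl
    ((mem_maxTrivSubmodule (R := k) (L := L) (M := N) z).mp hz x)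

open LieAlgebra LieModule in
/-- In characteristic zero, a finite-dimensional module `V` over a Lie algebra `L` with
nondegenerate Killing form is the sum of its invariants and of `L · V`. -/
lemma maxTrivSubmodule_sup_lie_top_eq_top_of_finiteDimensional
    {k L V : Type*} [Field k] [CharZero k]
    [LieRing L] [LieAlgebra k L] [FiniteDimensional k L] [IsKilling k L]
    [AddCommGroup V] [Module k V] [LieRingModule L V] [LieModule k L V] [FiniteDimensional k V] :
    maxTrivSubmodule k L V ⊔ ⁅(⊤ : LieIdeal k L), (⊤ : LieSubmodule k L V)⁆ = ⊤ := by
  induction hn : Module.finrank k V using Nat.strong_induction_on generalizing V with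
  | _ n ih =>
  let K : LieIdeal k L :=
    InvariantForm.orthogonal (traceForm k L V) (traceForm_lieInvariant k L V) ⊤
  have hK : ∀ y, y ∈ K ↔ ∀ x, traceForm k L V x y = 0 := by
    intro y
    simp [K, InvariantForm.mem_orthogonal]
  have hcompl := LieIdeal.isCompl_killingCompl K
  by_cases hI : K.killingCompl = ⊥
  · rw [hI] at hcompl
    have hKtop := eq_top_of_isCompl_bot hcompl
    have hzero : traceForm k L V = 0 := by
      ext x y
      exact (hK y).mp (hKtop ▸ LieSubmodule.mem_top y) x
    have hbot := lie_top_eq_bot_of_traceForm_eq_zero derivedSeries_one_eq_top_of_isKilling hzero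
    rw [LieSubmodule.lie_eq_bot_iff] at hbot
    refine eq_top_iff.mpr (le_sup_of_le_left fun v _ => ?_)
    rw [mem_maxTrivSubmodule]
    exact fun x => hbot x (LieSubmodule.mem_top x) v (LieSubmodule.mem_top v)
  have hB : (traceForm k K.killingCompl V).Nondegenerate := by
    refine (traceForm_isSymm k _ V).isRefl.nondegenerate_iff_separatingLeft.mpr ?_
    rintro ⟨y, hy⟩ hyz
    have hyK : y ∈ K := by
      rw [hK]
      intro x
      have hx : x ∈ K ⊔ K.killingCompl := hcompl.sup_eq_top ▸ LieSubmodule.mem_top x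
      obtain ⟨u, hu, w, hw, rfl⟩ := (LieSubmodule.mem_sup _ _ _).mp hx
      have h1 : traceForm k L V u y = 0 := by
        rw [traceForm_comm]
        exact (hK u).mp hu y
      have h2 : traceForm k L V w y = 0 := by
        rw [traceForm_comm]
        exact hyz ⟨w, hw⟩
      rw [map_add, LinearMap.add_apply, h1, h2, add_zero]
    have : y ∈ K ⊓ K.killingCompl := ⟨hyK, hy⟩
    rw [hcompl.inf_eq_bot, LieSubmodule.mem_bot] at this
    exact Subtype.ext this
  obtain ⟨C, hCmem, hCtr⟩ := exists_lieModuleHom_trace_ne_zero _ hI hB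
  let T : Module.End k V := C
  obtain ⟨m, hm1, hm⟩ := ((Filter.eventually_ge_atTop 1).and
    T.eventually_isCompl_ker_pow_range_pow).exists
  have hT : ∀ (j : ℕ) (x : L) (v : V), (T ^ j) ⁅x, v⁆ = ⁅x, (T ^ j) v⁆ := by
    intro j x v
    induction j with
    | zero => simp
    | succ j ihj =>
      rw [pow_succ', Module.End.mul_apply, Module.End.mul_apply, ihj]
      exact C.map_lie x _
  let N : LieSubmodule k L V :=
    { LinearMap.ker (T ^ m) with
      lie_mem := fun {x v} hv => by
        change (T ^ m) ⁅x, v⁆ = 0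
        rw [hT, show (T ^ m) v = 0 from hv, lie_zero] }
  have hNlt : Module.finrank k N < n := by
    rw [← hn]
    refine Submodule.finrank_lt (s := N.toSubmodule) fun htop => hCtr ?_
    have hTm : T ^ m = 0 := LinearMap.ker_eq_top.mp htop
    exact (LinearMap.isNilpotent_trace_of_isNilpotent ⟨m, hTm⟩).eq_zero
  have hN := ih _ hNlt (V := N) rfl
  refine eq_top_iff.mpr fun v _ => ?_
  have hv : v ∈ LinearMap.ker (T ^ m) ⊔ LinearMap.range (T ^ m) := hm.sup_eq_top ▸ trivial
  obtain ⟨u, hu, _, ⟨w, rfl⟩, rfl⟩ := Submodule.mem_sup.mp hv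
  refine add_mem ?_ (LieSubmodule.mem_sup_right ?_)
  · exact map_incl_maxTrivSubmodule_sup_lie_top_le N (LieSubmodule.mem_map_of_mem (f := N.incl)
      (hN.symm ▸ LieSubmodule.mem_top (⟨u, hu⟩ : N) :))
  · obtain ⟨j, rfl⟩ := Nat.exists_eq_add_of_le' hm1
    rw [pow_succ', Module.End.mul_apply]
    exact hCmem _

open LieAlgebra LieModule in
/-- The decomposition of a locally finite module into invariants and `L · M`. -/
lemma maxTrivSubmodule_sup_lie_top_eq_top_of_locallyFinite
    {k L M : Type*} [Field k] [CharZero k]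
    [LieRing L] [LieAlgebra k L] [FiniteDimensional k L] [IsKilling k L]
    [AddCommGroup M] [Module k M] [LieRingModule L M] [LieModule k L M]
    (hM : ∀ m : M, ∃ N : LieSubmodule k L M, FiniteDimensional k N ∧ m ∈ N) :
    maxTrivSubmodule k L M ⊔ ⁅(⊤ : LieIdeal k L), (⊤ : LieSubmodule k L M)⁆ = ⊤ := by
  refine eq_top_iff.mpr fun u _ => ?_
  obtain ⟨N, _, hu⟩ := hM u
  exact map_incl_maxTrivSubmodule_sup_lie_top_le N (LieSubmodule.mem_map_of_mem (f := N.incl)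
    (show (⟨u, hu⟩ : N) ∈ _ from
      (maxTrivSubmodule_sup_lie_top_eq_top_of_finiteDimensional (k := k) (L := L) (V := N)).symm ▸
        LieSubmodule.mem_top _))

/-- Two derivations agreeing on a generating set are equal. -/
lemma leibniz_ext_of_adjoin_eq_top {k S ι : Type*} [CommRing k] [CommRing S] [Algebra k S]
    {g : ι → S} (hgen : Algebra.adjoin k (Set.range g) = ⊤) {d d' : Module.End k S}
    (hd : ∀ a b, d (a * b) = d a * b + a * d b) (hd' : ∀ a b, d' (a * b) = d' a * b + a * d' b)
    (h : ∀ i, d (g i) = d' (g i)) : d = d' := by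
  have hder : ∀ {e : Module.End k S}, (∀ a b, e (a * b) = e a * b + a * e b) →
      ∀ a b, e (a * b) = a • e b + b • e a := by
    intro e he a b
    rw [he, smul_eq_mul, smul_eq_mul]
    ring
  have hext := Derivation.ext_of_adjoin_eq_top (D1 := Derivation.mk' d (hder hd))
    (D2 := Derivation.mk' d' (hder hd')) _ hgen (by rintro _ ⟨i, rfl⟩; exact h i)
  ext a
  exact DFunLike.congr_fun hext a

/-- An algebra generated by a finite-dimensional subspace is a union of finite-dimensional
subspaces stable under every family of derivations preserving that subspace. -/
lemma exists_finiteDimensional_stable_of_adjoin_eq_top {k V S ι : Type*} [Field k]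
    [AddCommGroup V] [Module k V] [FiniteDimensional k V] [CommRing S] [Algebra k S]
    (g : V →ₗ[k] S) (hgen : Algebra.adjoin k (Set.range g) = ⊤) (d : ι → Module.End k S)
    (hd : ∀ i a b, d i (a * b) = d i a * b + a * d i b)
    (hg : ∀ i v, d i (g v) ∈ LinearMap.range g) (a : S) :
    ∃ W : Submodule k S, FiniteDimensional k W ∧ (∀ i, ∀ w ∈ W, d i w ∈ W) ∧ a ∈ W := by
  have ha : a ∈ Algebra.adjoin k (Set.range g) := hgen ▸ Algebra.mem_top
  induction ha using Algebra.adjoin_induction with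
  | mem a ha =>
    refine ⟨LinearMap.range g, inferInstance, ?_, ha⟩
    rintro i _ ⟨v, rfl⟩
    exact hg i v
  | algebraMap r =>
    refine ⟨k ∙ (1 : S), inferInstance, ?_, ?_⟩
    · intro i w hw
      obtain ⟨c, rfl⟩ := Submodule.mem_span_singleton.mp hw
      have h1 : d i 1 = 0 := by simpa using hd i 1 1
      simp [h1]
    · rw [Algebra.algebraMap_eq_smul_one]
      exact Submodule.smul_mem _ _ (Submodule.mem_span_singleton_self _)
  | add a b _ _ iha ihb =>
    obtain ⟨W, _, hW, haW⟩ := iha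
    obtain ⟨W', _, hW', hbW'⟩ := ihb
    refine ⟨W ⊔ W', inferInstance, ?_, Submodule.add_mem_sup haW hbW'⟩
    intro i w hw
    obtain ⟨u, hu, v, hv, rfl⟩ := Submodule.mem_sup.mp hw
    rw [map_add]
    exact Submodule.add_mem_sup (hW i u hu) (hW' i v hv)
  | mul a b _ _ iha ihb =>
    obtain ⟨W, hWfin, hW, haW⟩ := iha
    obtain ⟨W', hWfin', hW', hbW'⟩ := ihb
    refine ⟨W * W', ?_, ?_, Submodule.mul_mem_mul haW hbW'⟩
    · rw [← Submodule.fg_iff_finiteDimensional] at hWfin hWfin' ⊢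
      exact hWfin.mul hWfin'
    · intro i w hw
      induction hw using Submodule.mul_induction_on' with
      | mem_mul_mem u hu v hv =>
        rw [hd]
        exact add_mem (Submodule.mul_mem_mul (hW i u hu) hv) (Submodule.mul_mem_mul hu (hW' i v hv))
      | add u _ v _ hu hv => rw [map_add]; exact add_mem hu hv

/-- Main theorem for semisimple `𝔤`, deduced from Duflo: For `𝔤` semisimple
finite-dimensional over a field of characteristic zero, for any `α ∈ [S(𝔤)]^𝔤` and any
`β ∈ S(𝔤)` there exists `c(α,β) ∈ {S(𝔤),S(𝔤)}` (the span of Kostant–Kirillov Poisson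
brackets) such that `φ_D(α·β + c(α,β)) = φ_D(α) ⋆ φ_D(β)`, where `⋆` is the product in
`U(𝔤)`.  Here `φ_D` is the Duflo map: a bijective morphism of `𝔤`-modules
`S(𝔤) → U(𝔤)` whose restriction to invariants is an algebra map with image the
invariants (= center) of `U(𝔤)`. -/
theorem main_theorem_semisimple
    {k : Type} [Field k] [CharZero k]
    {𝔤 : Type} [LieRing 𝔤] [LieAlgebra k 𝔤] [FiniteDimensional k 𝔤]
    [LieAlgebra.IsSemisimple k 𝔤]
    {S : Type} [CommRing S] [Algebra k S]
    (ιS : 𝔤 →ₗ[k] S)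
    (hgen : Algebra.adjoin k (Set.range ιS) = ⊤)
    -- the Kostant–Kirillov Poisson bracket on `S(𝔤)`
    (P : S →ₗ[k] S →ₗ[k] S)
    (hPanti : ∀ a c : S, P a c = -P c a)
    (hPder : ∀ a c e : S, P a (c * e) = P a c * e + c * P a e)
    (hPι : ∀ x y : 𝔤, P (ιS x) (ιS y) = ιS ⁅x, y⁆)
    -- the adjoint action of `𝔤` on `S(𝔤)` by derivations
    (D : 𝔤 →ₗ[k] Module.End k S)
    (hDer : ∀ (x : 𝔤) (a c : S), D x (a * c) = D x a * c + a * D x c)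
    (hDι : ∀ x y : 𝔤, D x (ιS y) = ιS ⁅x, y⁆)
    -- the Duflo map: a `𝔤`-module isomorphism, algebra map on invariants,
    -- mapping the invariants of `S(𝔤)` onto the invariants of `U(𝔤)`
    (φD : S →ₗ[k] UniversalEnvelopingAlgebra k 𝔤)
    (hbij : Function.Bijective φD)
    (hmod : ∀ (x : 𝔤) (a : S),
      φD (D x a) = UniversalEnvelopingAlgebra.ι k x * φD a
        - φD a * UniversalEnvelopingAlgebra.ι k x)
    (hmult : ∀ a c : S, (∀ x : 𝔤, D x a = 0) → (∀ x : 𝔤, D x c = 0) →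
      φD (a * c) = φD a * φD c)
    (hinv : Set.BijOn φD {a : S | ∀ x : 𝔤, D x a = 0}
      {u : UniversalEnvelopingAlgebra k 𝔤 | ∀ x : 𝔤,
        UniversalEnvelopingAlgebra.ι k x * u - u * UniversalEnvelopingAlgebra.ι k x = 0}) :
    ∀ a e : S, (∀ x : 𝔤, D x a = 0) →
      ∃ c ∈ Submodule.span k {c' : S | ∃ u v : S, P u v = c'},
        φD (a * e + c) = φD a * φD e := by
  intro a e ha
  have hPD : ∀ x : 𝔤, P (ιS x) = D x := fun x =>
    leibniz_ext_of_adjoin_eq_top hgen (hPder (ιS x)) (hDer x) fun y => by rw [hPι, hDι]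
  have hDlie : ∀ (x y : 𝔤) (s : S), D x (D y s) = D ⁅x, y⁆ s + D y (D x s) := by
    intro x y s
    apply hbij.injective
    rw [map_add]
    simp only [hmod, LieHom.map_lie, LieRing.of_associative_ring_bracket]
    noncomm_ring
  let _ : LieRingModule 𝔤 S :=
    { bracket := fun x s => D x s
      add_lie := fun x y s => by change D (x + y) s = D x s + D y s; simp
      lie_add := fun x s t => map_add (D x) s t
      leibniz_lie := hDlie }
  have _ : LieModule k 𝔤 S :=
    { smul_lie := fun r x s => by change D (r • x) s = r • D x s; simp
      lie_smul := fun r x s => map_smul (D x) r s }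
  have hfin : ∀ s : S, ∃ N : LieSubmodule k 𝔤 S, FiniteDimensional k N ∧ s ∈ N := by
    intro s
    obtain ⟨W, hWfin, hW, hs⟩ := exists_finiteDimensional_stable_of_adjoin_eq_top ιS hgen D hDer
      (fun x y => ⟨⁅x, y⁆, (hDι x y).symm⟩) s
    exact ⟨{ W with lie_mem := fun {x w} hw => hW x w hw }, hWfin, hs⟩
  have he : e ∈ LieModule.maxTrivSubmodule k 𝔤 S ⊔
      ⁅(⊤ : LieIdeal k 𝔤), (⊤ : LieSubmodule k 𝔤 S)⁆ :=
    (maxTrivSubmodule_sup_lie_top_eq_top_of_locallyFinite hfin).symm ▸ LieSubmodule.mem_top e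
  obtain ⟨e₀, he₀, e₁, he₁, rfl⟩ := (LieSubmodule.mem_sup _ _ _).mp he
  have he₀' : ∀ x : 𝔤, D x e₀ = 0 :=
    (LieModule.mem_maxTrivSubmodule (R := k) (L := 𝔤) (M := S) e₀).mp he₀
  have hDspan : ∀ x s, D x s ∈ Submodule.span k {c' : S | ∃ u v : S, P u v = c'} :=
    fun x s => Submodule.subset_span ⟨ιS x, s, by rw [hPD]⟩
  suffices ∃ c ∈ Submodule.span k {c' : S | ∃ u v : S, P u v = c'},
      φD (a * e₁ + c) = φD a * φD e₁ by
    obtain ⟨c, hc, hφ⟩ := this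
    refine ⟨c, hc, ?_⟩
    rw [mul_add, add_assoc, map_add, hφ, hmult a e₀ ha he₀', map_add, mul_add]
  clear he
  rw [← LieSubmodule.mem_toSubmodule, LieSubmodule.lieIdeal_oper_eq_linear_span'] at he₁
  induction he₁ using Submodule.span_induction with
  | mem s hs =>
    obtain ⟨x, -, t, -, rfl⟩ := hs
    obtain ⟨w, hw⟩ := hbij.surjective (φD a * φD t)
    refine ⟨D x w - D x (a * t), sub_mem (hDspan x w) (hDspan x _), ?_⟩
    have hax := hmod x a
    rw [ha x, map_zero, eq_comm, sub_eq_zero] at hax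
    change φD (a * D x t + _) = φD a * φD (D x t)
    rw [hDer, ha x, zero_mul, zero_add, add_sub_cancel, hmod, hmod, hw, mul_sub, ← mul_assoc, hax]
    noncomm_ring
  | zero => exact ⟨0, zero_mem _, by simp⟩
  | add s t _ _ hs ht =>
    obtain ⟨c, hc, hφ⟩ := hs
    obtain ⟨c', hc', hφ'⟩ := ht
    refine ⟨c + c', add_mem hc hc', ?_⟩
    rw [mul_add, add_add_add_comm, map_add, hφ, hφ', map_add, mul_add]
  | smul r s _ hs =>
    obtain ⟨c, hc, hφ⟩ := hs
    refine ⟨r • c, Submodule.smul_mem _ r hc, ?_⟩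
    rw [mul_smul_comm, ← smul_add, map_smul, hφ, map_smul, mul_smul_comm]
end
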